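/- arXiv:math/0103102 — 2 statements merged into one kernel-verified Lean document; each statement's English description precedes it below -/
import Mathlib

section
/- Suppose φ and g are continuously differentiable and the first-order KKT conditions are satisfied at z = z* for at least one multiplier, so that S_λ is nonempty. Then S_λ is bounded if and only if the Mangasarian–Fromovitz constraint qualification (MFCQ) is satisfied at z*. -/
open Matrix
open scoped BigOperators

noncomputable section

attribute [local instance] Classical.propDecidable

/-- Euclidean norm of a finitely indexed family of real numbers. -/
def evnorm {ι : Type*} [Fintype ι] (v : ι → ℝ) : ℝ :=
  Real.sqrt (∑ i, v i ^ 2)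

/-- Frobenius norm of a real matrix. -/
def mnorm {ι κ : Type*} [Fintype ι] [Fintype κ] (M : Matrix ι κ ℝ) : ℝ :=
  Real.sqrt (∑ i, ∑ j, M i j ^ 2)

/-- Smallest singular value of a real matrix. -/
def sigmaMin {ι κ : Type*} [Fintype ι] [Fintype κ] (M : Matrix ι κ ℝ) : ℝ :=
  sInf {t | ∃ x : κ → ℝ, evnorm x = 1 ∧ t = evnorm (M.mulVec x)}

/-- The continuous linear functional `x ↦ ⟨v, x⟩` on `ℝⁿ`. -/
def dotCLM {n : ℕ} (v : Fin n → ℝ) : (Fin n → ℝ) →L[ℝ] ℝ :=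
  ∑ i, v i • (ContinuousLinearMap.proj (R := ℝ) (φ := fun _ : Fin n => ℝ) i)

/-- The continuous linear map `x ↦ M x` on `ℝⁿ`. -/
def matCLM {n : ℕ} (M : Matrix (Fin n) (Fin n) ℝ) : (Fin n → ℝ) →L[ℝ] (Fin n → ℝ) :=
  LinearMap.toContinuousLinearMap (Matrix.toLin' M)

/-- Duality measure `μ(λ,s) = λᵀ s / m`. -/
def dmu {m : ℕ} (lam s : Fin m → ℝ) : ℝ := (∑ i, lam i * s i) / (m : ℝ)

/-- Data of the nonlinear program `min φ(z)  s.t.  g(z) ≤ 0`, with `φ` and each `gᵢ`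
twice Lipschitz continuously differentiable; `gradphi`, `gradg` are the gradients and
`hessphi`, `hessg` the (symmetric) Hessians. -/
structure NLP (n m : ℕ) where
  phi : (Fin n → ℝ) → ℝ
  g : Fin m → (Fin n → ℝ) → ℝ
  gradphi : (Fin n → ℝ) → Fin n → ℝ
  gradg : Fin m → (Fin n → ℝ) → Fin n → ℝ
  hessphi : (Fin n → ℝ) → Matrix (Fin n) (Fin n) ℝ
  hessg : Fin m → (Fin n → ℝ) → Matrix (Fin n) (Fin n) ℝ
  grad_phi : ∀ z, HasFDerivAt phi (dotCLM (gradphi z)) z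
  grad_g : ∀ i z, HasFDerivAt (g i) (dotCLM (gradg i z)) z
  hess_phi : ∀ z, HasFDerivAt gradphi (matCLM (hessphi z)) z
  hess_g : ∀ i z, HasFDerivAt (gradg i) (matCLM (hessg i z)) z
  hessphi_symm : ∀ z, (hessphi z).IsSymm
  hessg_symm : ∀ i z, (hessg i z).IsSymm
  lip_phi : ∃ K, ∀ z z', mnorm (hessphi z - hessphi z') ≤ K * evnorm (z - z')
  lip_g : ∀ i, ∃ K, ∀ z z', mnorm (hessg i z - hessg i z') ≤ K * evnorm (z - z')

namespace NLP

variable {n m : ℕ} (P : NLP n m)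

/-- Gradient of the Lagrangian with respect to `z`:  `L_z(z,λ) = ∇φ(z) + ∇g(z)λ`. -/
def Lz (z : Fin n → ℝ) (lam : Fin m → ℝ) : Fin n → ℝ :=
  fun j => P.gradphi z j + ∑ i, lam i * P.gradg i z j

/-- Hessian of the Lagrangian with respect to `z`. -/
def Lzz (z : Fin n → ℝ) (lam : Fin m → ℝ) : Matrix (Fin n) (Fin n) ℝ :=
  P.hessphi z + ∑ i, lam i • P.hessg i z

/-- The KKT conditions at `(z, λ)`. -/
def KKT (z : Fin n → ℝ) (lam : Fin m → ℝ) : Prop :=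
  P.Lz z lam = 0 ∧ (∀ i, P.g i z ≤ 0) ∧ (∀ i, 0 ≤ lam i) ∧ (∑ i, lam i * P.g i z) = 0

/-- The set `S_λ` of optimal Lagrange multipliers at `z*`. -/
def Slam (zstar : Fin n → ℝ) : Set (Fin m → ℝ) := {lam | P.KKT zstar lam}

/-- The Mangasarian–Fromovitz constraint qualification at `z*`. -/
def MFCQ (zstar : Fin n → ℝ) : Prop :=
  ∃ ybar : Fin n → ℝ, ∀ i, P.g i zstar = 0 → (∑ j, P.gradg i zstar j * ybar j) < 0

/-- The index set `B₊` of active constraints with a positive multiplier. -/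
def BPlus (zstar : Fin n → ℝ) : Set (Fin m) :=
  {i | P.g i zstar = 0 ∧ ∃ ls ∈ P.Slam zstar, 0 < ls i}

/-- The second-order sufficient condition at `z*`. -/
def SOC (zstar : Fin n → ℝ) : Prop :=
  ∃ ξ : ℝ, 0 < ξ ∧ ∀ ls ∈ P.Slam zstar, ∀ w : Fin n → ℝ,
    (∀ i, i ∈ P.BPlus zstar → (∑ j, P.gradg i zstar j * w j) = 0) →
    (∀ i, P.g i zstar = 0 → i ∉ P.BPlus zstar → (∑ j, P.gradg i zstar j * w j) ≤ 0) →
    ξ * evnorm w ^ 2 ≤ w ⬝ᵥ (P.Lzz zstar ls).mulVec w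

/-- The strict complementarity condition `B₊ = B` at `z*`. -/
def StrictComp (zstar : Fin n → ℝ) : Prop :=
  ∀ i, P.g i zstar = 0 → i ∈ P.BPlus zstar

/-- `z*` is a solution of the nonlinear program: it is feasible, it is a local
minimizer, and the first-order KKT conditions hold there. -/
def isSolution (zstar : Fin n → ℝ) : Prop :=
  (∀ i, P.g i zstar ≤ 0) ∧ (∃ lam, P.KKT zstar lam) ∧
  ∀ᶠ z in nhds zstar, (∀ i, P.g i z ≤ 0) → P.phi zstar ≤ P.phi z

/-- Euclidean distance `δ(z,λ)` from `(z,λ)` to the primal–dual solution set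
`S = {z*} × S_λ`. -/
def delta (zstar z : Fin n → ℝ) (lam : Fin m → ℝ) : ℝ :=
  sInf {d | ∃ ls ∈ P.Slam zstar,
    d = Real.sqrt (evnorm (z - zstar) ^ 2 + evnorm (lam - ls) ^ 2)}

/-- The approximate centrality conditions with constants `C`, `γ`. -/
def central (C gam : ℝ) (z : Fin n → ℝ) (lam s : Fin m → ℝ) : Prop :=
  evnorm (P.Lz z lam) ≤ C * dmu lam s ∧
  evnorm (fun i => P.g i z + s i) ≤ C * dmu lam s ∧
  (∀ i, 0 < lam i) ∧ (∀ i, 0 < s i) ∧ (∀ i, gam * dmu lam s ≤ lam i * s i)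

/-- The active index set `B` at `z*`, as a type. -/
abbrev Bsub (zstar : Fin n → ℝ) : Type := {i : Fin m // P.g i zstar = 0}

/-- The inactive index set `N` at `z*`, as a type. -/
abbrev Nsub (zstar : Fin n → ℝ) : Type := {i : Fin m // ¬ P.g i zstar = 0}

/-- `∇g(z)`:  the `n × m` matrix whose columns are the constraint gradients. -/
def Gfull (z : Fin n → ℝ) : Matrix (Fin n) (Fin m) ℝ :=
  Matrix.of fun j i => P.gradg i z j

/-- `∇g_B(z)`:  the columns of `∇g(z)` indexed by the active set `B` at `z*`. -/
def GB (zstar z : Fin n → ℝ) : Matrix (Fin n) (P.Bsub zstar) ℝ :=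
  Matrix.of fun j b => P.gradg b.1 z j

/-- `∇g_N(z)`:  the columns of `∇g(z)` indexed by the inactive set `N` at `z*`. -/
def GN (zstar z : Fin n → ℝ) : Matrix (Fin n) (P.Nsub zstar) ℝ :=
  Matrix.of fun j b => P.gradg b.1 z j

/-- The diagonal matrix `D_B = Λ_B⁻¹ S_B`. -/
def DB (zstar : Fin n → ℝ) (lam s : Fin m → ℝ) :
    Matrix (P.Bsub zstar) (P.Bsub zstar) ℝ :=
  Matrix.diagonal fun b => s b.1 / lam b.1

/-- The diagonal matrix `D_N = Λ_N⁻¹ S_N`. -/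
def DN (zstar : Fin n → ℝ) (lam s : Fin m → ℝ) :
    Matrix (P.Nsub zstar) (P.Nsub zstar) ℝ :=
  Matrix.diagonal fun b => s b.1 / lam b.1

/-- The exact primal–dual step: the solution of the linear system (pdip.orig). -/
def exactStep (z : Fin n → ℝ) (lam s t : Fin m → ℝ) (dz : Fin n → ℝ)
    (dl ds : Fin m → ℝ) : Prop :=
  (∀ j, ((P.Lzz z lam).mulVec dz) j + ((P.Gfull z).mulVec dl) j = -(P.Lz z lam j)) ∧
  (∀ i, (((P.Gfull z)ᵀ).mulVec dz) i + ds i = -(P.g i z + s i)) ∧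
  (∀ i, s i * dl i + lam i * ds i = -(s i * lam i + t i))

end NLP

/-- Part (a) of Assumption A: `z*` is a solution at which MFCQ, the second-order
condition, and strict complementarity hold, and the current iterate `(z,λ,s)`
satisfies the approximate centrality conditions with constants `C`, `γ`. -/
def AssumptionAa {n m : ℕ} (P : NLP n m) (zstar : Fin n → ℝ) (C gam : ℝ)
    (z : Fin n → ℝ) (lam s : Fin m → ℝ) : Prop :=
  P.isSolution zstar ∧ P.MFCQ zstar ∧ P.SOC zstar ∧ P.StrictComp zstar ∧
  P.central C gam z lam s

/-- The data of a singular value decomposition `∇g_B(z*) = Û Σ Uᵀ`, where the square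
matrices `[Û V̂]` (of order `n`) and `[U V]` (of order `|B|`) are orthogonal and `Σ` is
diagonal with positive diagonal entries. -/
structure SVDdata {n m : ℕ} (P : NLP n m) (zstar : Fin n → ℝ) where
  k : ℕ
  kc : ℕ
  r : ℕ
  Uhat : Matrix (Fin n) (Fin k) ℝ
  Vhat : Matrix (Fin n) (Fin kc) ℝ
  U : Matrix (P.Bsub zstar) (Fin k) ℝ
  V : Matrix (P.Bsub zstar) (Fin r) ℝ
  sig : Fin k → ℝ
  sig_pos : ∀ j, 0 < sig j
  hUhat : Uhatᵀ * Uhat = 1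
  hVhat : Vhatᵀ * Vhat = 1
  hUVhat : Uhatᵀ * Vhat = 0
  hhat_complete : Uhat * Uhatᵀ + Vhat * Vhatᵀ = 1
  hU : Uᵀ * U = 1
  hV : Vᵀ * V = 1
  hUV : Uᵀ * V = 0
  h_complete : U * Uᵀ + V * Vᵀ = 1
  hsvd : P.GB zstar zstar = Uhat * Matrix.diagonal sig * Uᵀ

/-- **Gordan's alternative** for the rows of `a` indexed by a set `s`: either some `y` makes a
negative product with each of these rows, or some convex combination of them vanishes. -/
theorem exists_forall_sum_mul_neg_or_exists_stdSimplex {ι κ : Type*} [Fintype ι] [Fintype κ]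
    (a : ι → κ → ℝ) (s : Set ι) :
    (∃ y : κ → ℝ, ∀ i ∈ s, ∑ j, a i j * y j < 0) ∨
      ∃ w ∈ stdSimplex ℝ ι, (∀ i ∉ s, w i = 0) ∧ ∀ j, ∑ i, w i * a i j = 0 := by
  set L : (ι → ℝ) →ₗ[ℝ] (κ → ℝ) := Fintype.linearCombination ℝ a with hL
  have hLapply (w : ι → ℝ) (j : κ) : L w j = ∑ i, w i * a i j := by
    simp [hL, Fintype.linearCombination_apply]
  let F : Submodule ℝ (ι → ℝ) := Submodule.pi sᶜ fun _ => ⊥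
  have hF (w : ι → ℝ) : w ∈ F ↔ ∀ i ∉ s, w i = 0 := by simp [F, Submodule.mem_pi]
  set K : Set (ι → ℝ) := stdSimplex ℝ ι ∩ F
  by_cases h0 : (0 : κ → ℝ) ∈ L '' K
  · obtain ⟨w, ⟨hw, hwF⟩, hLw⟩ := h0
    exact .inr ⟨w, hw, (hF w).1 hwF, fun j => by rw [← hLapply, hLw, Pi.zero_apply]⟩
  · left
    have hconv : Convex ℝ (L '' K) := ((convex_stdSimplex ℝ ι).inter F.convex).linear_image L
    have hcomp : IsCompact (L '' K) :=
      ((isCompact_stdSimplex ℝ ι).inter_right F.closed_of_finiteDimensional).image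
        L.continuous_of_finiteDimensional
    obtain ⟨f, u, hu, hf⟩ := geometric_hahn_banach_point_closed hconv hcomp.isClosed h0
    rw [map_zero] at hu
    refine ⟨fun j => -f (Pi.single j 1), fun i hi => ?_⟩
    have hrow : a i ∈ L '' K := by
      refine ⟨Pi.single i 1, ⟨single_mem_stdSimplex ℝ i, (hF _).2 fun k hk => ?_⟩, ?_⟩
      · exact Pi.single_eq_of_ne (ne_of_mem_of_not_mem hi hk).symm _
      · simp [hL]
    have hfa : f (a i) = ∑ j, a i j * f (Pi.single j 1) := by
      conv_lhs => rw [pi_eq_sum_univ' (a i)]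
      simp [map_sum]
    have := hf _ hrow
    simp only [mul_neg, Finset.sum_neg_distrib, ← hfa]
    linarith

theorem le_evnorm {ι : Type*} [Fintype ι] (v : ι → ℝ) (i : ι) : v i ≤ evnorm v :=
  Real.le_sqrt_of_sq_le
    (Finset.single_le_sum (f := fun i => v i ^ 2) (fun _ _ => sq_nonneg _) (Finset.mem_univ i))

theorem evnorm_le_evnorm {ι : Type*} [Fintype ι] {v w : ι → ℝ} (h : ∀ i, |v i| ≤ |w i|) :
    evnorm v ≤ evnorm w :=
  Real.sqrt_le_sqrt (Finset.sum_le_sum fun i _ => sq_le_sq.2 (h i))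

/-- A nonnegative ray `lam + t w` with `w` in the standard simplex leaves every ball. -/
theorem exists_nonneg_lt_evnorm_add_smul {ι : Type*} [Fintype ι] {lam w : ι → ℝ}
    (hlam : ∀ i, 0 ≤ lam i) (hw : w ∈ stdSimplex ℝ ι) (R : ℝ) :
    ∃ t : ℝ, 0 ≤ t ∧ R < evnorm (fun i => lam i + t * w i) := by
  obtain ⟨k, -, hk⟩ : ∃ k ∈ Finset.univ, 0 < w k :=
    Finset.exists_lt_of_sum_lt (f := fun _ => 0) (by simp [hw.2])
  refine ⟨(|R| + 1) / w k, by positivity, ?_⟩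
  have hle := le_evnorm (fun i => lam i + (|R| + 1) / w k * w i) k
  simp only [div_mul_cancel₀ _ hk.ne'] at hle
  linarith [hlam k, le_abs_self R]

/-- Complementarity of a nonnegative and a nonpositive vector holds coordinatewise. -/
theorem mul_eq_zero_of_sum_mul_eq_zero {ι : Type*} [Fintype ι] {lam c : ι → ℝ}
    (hlam : ∀ i, 0 ≤ lam i) (hc : ∀ i, c i ≤ 0) (h : ∑ i, lam i * c i = 0) (i : ι) :
    lam i * c i = 0 :=
  (Finset.sum_eq_zero_iff_of_nonpos
    fun i _ => mul_nonpos_of_nonneg_of_nonpos (hlam i) (hc i)).1 h i (Finset.mem_univ i)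

/-- A bound on the multipliers of the constraints along which `y` is a strict descent direction. -/
theorem multiplier_mul_le {ι κ : Type*} [Fintype ι] [Fintype κ] {p : κ → ℝ} {a : ι → κ → ℝ}
    {lam : ι → ℝ} {y : κ → ℝ} (hstat : ∀ j, p j + ∑ i, lam i * a i j = 0)
    (hlam : ∀ i, 0 ≤ lam i) (hy : ∀ i, lam i ≠ 0 → ∑ j, a i j * y j < 0) (i : ι) :
    lam i * -∑ j, a i j * y j ≤ ∑ j, p j * y j := by
  have hsum : ∑ j, p j * y j = ∑ i, lam i * -∑ j, a i j * y j := by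
    simp_rw [fun j => eq_neg_of_add_eq_zero_left (hstat j), neg_mul, Finset.sum_mul, mul_neg,
      Finset.mul_sum, Finset.sum_neg_distrib, mul_assoc]
    rw [Finset.sum_comm]
  rw [hsum]
  refine Finset.single_le_sum (f := fun i => lam i * -∑ j, a i j * y j) (fun k _ => ?_)
    (Finset.mem_univ i)
  by_cases hk : lam k = 0
  · simp [hk]
  · exact mul_nonneg (hlam k) (neg_nonneg.2 (hy k hk).le)

/-- **Gauvin.** Suppose `φ` and `g` are continuously differentiable and
the first-order KKT conditions are satisfied at `z = z*` for at least one multiplier,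
so that `S_λ` is nonempty.  Then `S_λ` is bounded if and only if the
Mangasarian–Fromovitz constraint qualification is satisfied at `z*`. -/
theorem stmt0_gauvin_bounded_iff_MFCQ
    {n m : ℕ}
    (phi : (Fin n → ℝ) → ℝ) (g : Fin m → (Fin n → ℝ) → ℝ)
    (gradphi : (Fin n → ℝ) → Fin n → ℝ)
    (gradg : Fin m → (Fin n → ℝ) → Fin n → ℝ)
    (hphi : ∀ z, HasFDerivAt phi (dotCLM (gradphi z)) z)
    (hg : ∀ i z, HasFDerivAt (g i) (dotCLM (gradg i z)) z)
    (hphic : Continuous gradphi) (hgc : ∀ i, Continuous (gradg i))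
    (zstar : Fin n → ℝ)
    (Slam : Set (Fin m → ℝ))
    (hSlam : Slam = {lam |
        (∀ j, gradphi zstar j + ∑ i, lam i * gradg i zstar j = 0) ∧
        (∀ i, g i zstar ≤ 0) ∧ (∀ i, 0 ≤ lam i) ∧
        (∑ i, lam i * g i zstar) = 0})
    (hne : Slam.Nonempty) :
    (∃ R : ℝ, ∀ lam ∈ Slam, evnorm lam ≤ R) ↔
      (∃ ybar : Fin n → ℝ, ∀ i, g i zstar = 0 →
        (∑ j, gradg i zstar j * ybar j) < 0) := by
  subst hSlam
  constructor
  · rintro ⟨R, hR⟩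
    obtain ⟨lam, hstat, hfeas, hlam, hcompl⟩ := hne
    refine (exists_forall_sum_mul_neg_or_exists_stdSimplex (fun i => gradg i zstar)
      {i | g i zstar = 0}).resolve_right ?_
    rintro ⟨w, hw, hwB, hw0⟩
    obtain ⟨t, ht, htR⟩ := exists_nonneg_lt_evnorm_add_smul hlam hw R
    refine htR.not_ge (hR _ ⟨fun j => ?_, hfeas, fun i => ?_, ?_⟩)
    · simp only [add_mul, mul_assoc, Finset.sum_add_distrib, ← Finset.mul_sum, hw0 j, mul_zero,
        add_zero, hstat j]
    · exact add_nonneg (hlam i) (mul_nonneg ht (hw.1 i))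
    · have hwg (i : Fin m) : w i * g i zstar = 0 := by
        by_cases hi : g i zstar = 0
        · rw [hi, mul_zero]
        · rw [hwB i hi, zero_mul]
      simp only [add_mul, mul_assoc, hwg, mul_zero, add_zero, hcompl]
  · rintro ⟨y, hy⟩
    refine ⟨evnorm fun i =>
      (∑ j, gradphi zstar j * y j) / -∑ j, gradg i zstar j * y j, ?_⟩
    rintro lam ⟨hstat, hfeas, hlam, hcompl⟩
    have hact (i : Fin m) (hi : lam i ≠ 0) : ∑ j, gradg i zstar j * y j < 0 :=
      hy i ((mul_eq_zero.1 (mul_eq_zero_of_sum_mul_eq_zero hlam hfeas hcompl i)).resolve_left hi)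
    refine evnorm_le_evnorm fun i => ?_
    by_cases hi : lam i = 0
    · simp [hi]
    · rw [abs_of_nonneg (hlam i)]
      exact ((le_div_iff₀ (neg_pos.2 (hact i hi))).2
        (multiplier_mul_le hstat hlam hact i)).trans (le_abs_self _)
end
end

section
/- Suppose the KKT conditions are satisfied at z = z*, and that MFCQ and the second-order condition hold at z*. Then there exist constants c₂ ≥ c₁ > 0 and a neighborhood W of the solution set S such that for all (z,λ) ∈ W with λ ≥ 0, c₁·η(z,λ) ≤ δ(z,λ) ≤ c₂·η(z,λ), where η(z,λ) = ‖(L_z(z,λ), min(λ, −g(z)))‖ and the minimum is taken componentwise. -/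
open Matrix
open scoped BigOperators

noncomputable section

attribute [local instance] Classical.propDecidable

section HoffmanBound

open Filter Topology

variable {E F : Type*} [NormedAddCommGroup E] [NormedSpace ℝ E]
  [NormedAddCommGroup F] [NormedSpace ℝ F]

/-- A continuous linear map that is injective at `0` on a closed cone of a finite-dimensional
space is bounded below on that cone. -/
theorem exists_norm_le_mul_norm_of_isClosed_cone [ProperSpace E] (A : E →L[ℝ] F) {K : Set E}
    (hK : IsClosed K) (hsmul : ∀ t : ℝ, 0 < t → ∀ u ∈ K, t • u ∈ K)
    (hA : ∀ u ∈ K, A u = 0 → u = 0) :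
    ∃ C : ℝ, 0 < C ∧ ∀ u ∈ K, ‖u‖ ≤ C * ‖A u‖ := by
  have hmem : ∀ u ∈ K, u ≠ 0 → ‖u‖⁻¹ • u ∈ K ∩ Metric.sphere 0 1 := fun u hu h0 =>
    ⟨hsmul _ (inv_pos.2 (norm_pos_iff.2 h0)) u hu, by simp [norm_smul, h0]⟩
  rcases (K ∩ Metric.sphere (0 : E) 1).eq_empty_or_nonempty with he | hne
  · refine ⟨1, one_pos, fun u hu => ?_⟩
    by_cases h0 : u = 0
    · simp [h0]
    · have := hmem u hu h0
      simp [he] at this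
  · obtain ⟨v, hv, hmin⟩ := ((isCompact_sphere (0 : E) 1).inter_left hK).exists_isMinOn hne
      (f := fun u => ‖A u‖) (by fun_prop)
    have hv0 : v ≠ 0 := by
      rintro rfl
      simpa using hv.2
    have hpos : 0 < ‖A v‖ := norm_pos_iff.2 fun h => hv0 (hA v hv.1 h)
    refine ⟨‖A v‖⁻¹, inv_pos.2 hpos, fun u hu => ?_⟩
    by_cases h0 : u = 0
    · simp [h0]
    · have hu0 : 0 < ‖u‖ := norm_pos_iff.2 h0
      have : ‖A v‖ ≤ ‖A (‖u‖⁻¹ • u)‖ := hmin (hmem u hu h0)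
      rw [map_smul, norm_smul, norm_inv, norm_norm, ← div_eq_inv_mul, le_div_iff₀ hu0] at this
      rwa [← div_eq_inv_mul, le_div_iff₀ hpos, mul_comm]

/-- The closed orthant face of all vectors whose signs are compatible with `σ`. -/
def signCone {ι : Type*} (σ : ι → SignType) : Set (ι → ℝ) :=
  {u | ∀ i, (σ i = 1 → 0 ≤ u i) ∧ (σ i = -1 → u i ≤ 0) ∧ (σ i = 0 → u i = 0)}

theorem isClosed_signCone {ι : Type*} (σ : ι → SignType) : IsClosed (signCone σ) := by
  simp only [signCone, Set.ofPred_forall, Set.ofPred_and]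
  refine isClosed_iInter fun i => IsClosed.inter ?_ (IsClosed.inter ?_ ?_)
  · exact isClosed_iInter fun _ => isClosed_le continuous_const (continuous_apply i)
  · exact isClosed_iInter fun _ => isClosed_le (continuous_apply i) continuous_const
  · exact isClosed_iInter fun _ => isClosed_eq (continuous_apply i) continuous_const

theorem smul_mem_signCone {ι : Type*} (σ : ι → SignType) (t : ℝ) (ht : 0 < t) (u : ι → ℝ)
    (hu : u ∈ signCone σ) : t • u ∈ signCone σ := fun i =>
  ⟨fun h => mul_nonneg ht.le ((hu i).1 h),
    fun h => mul_nonpos_of_nonneg_of_nonpos ht.le ((hu i).2.1 h),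
    fun h => by simp [(hu i).2.2 h]⟩

theorem mem_signCone_sign {ι : Type*} (u : ι → ℝ) :
    u ∈ signCone fun i => SignType.sign (u i) := fun _ =>
  ⟨fun h => (sign_eq_one_iff.1 h).le, fun h => (sign_eq_neg_one_iff.1 h).le, sign_eq_zero_iff.1⟩

/-- Let `y` be an `ℓ¹`-closest point to `x` in `{y ≥ 0, A y = b}`. Then no nonzero element of the
kernel of `A` has signs compatible with those of `x - y`. -/
theorem eq_zero_of_mem_signCone_of_isMinOn {ι : Type*} [Fintype ι] (A : (ι → ℝ) →L[ℝ] F) {b : F}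
    {x y w : ι → ℝ} (hx : ∀ i, 0 ≤ x i) (hy : ∀ i, 0 ≤ y i) (hAy : A y = b)
    (hmin : IsMinOn (fun y => ∑ i, |x i - y i|) {y | (∀ i, 0 ≤ y i) ∧ A y = b} y)
    (hw : w ∈ signCone fun i => SignType.sign (x i - y i)) (hAw : A w = 0) : w = 0 := by
  have hw' : ∀ i, (0 < x i - y i → 0 ≤ w i) ∧ (x i - y i < 0 → w i ≤ 0) ∧
      (x i - y i = 0 → w i = 0) := fun i =>
    ⟨fun h => (hw i).1 (sign_eq_one_iff.2 h), fun h => (hw i).2.1 (sign_eq_neg_one_iff.2 h),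
      fun h => (hw i).2.2 (sign_eq_zero_iff.2 h)⟩
  have hev : ∀ᶠ t : ℝ in 𝓝[>] 0, ∀ i, t * |w i| ≤ |x i - y i| := by
    refine eventually_all.2 fun i => ?_
    by_cases h0 : x i - y i = 0
    · simp [h0, (hw' i).2.2 h0]
    · have : Tendsto (fun t : ℝ => t * |w i|) (𝓝 0) (𝓝 (0 * |w i|)) :=
        tendsto_id.mul_const _
      rw [zero_mul] at this
      exact ((this.eventually_lt_const (abs_pos.2 h0)).mono fun _ h => h.le).filter_mono
        nhdsWithin_le_nhds
  obtain ⟨t, ht, ht0⟩ := (hev.and self_mem_nhdsWithin).exists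
  have ht0 : 0 < t := ht0
  have hco : ∀ i, 0 ≤ y i + t * w i ∧ |x i - (y i + t * w i)| = |x i - y i| - t * |w i| := by
    intro i
    have hti := ht i
    have hxi := hx i
    have hyi := hy i
    rcases lt_trichotomy (x i - y i) 0 with h | h | h
    · have hwi := (hw' i).2.1 h
      rw [abs_of_neg h, abs_of_nonpos hwi] at hti ⊢
      rw [abs_of_nonpos (by linarith)]
      constructor <;> linarith
    · have hwi := (hw' i).2.2 h
      simp [hwi, hyi]
    · have hwi := (hw' i).1 h
      have := mul_nonneg ht0.le hwi
      rw [abs_of_pos h, abs_of_nonneg hwi] at hti ⊢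
      rw [abs_of_nonneg (by linarith)]
      constructor <;> linarith
  have hle : ∑ i, |x i - y i| ≤ ∑ i, |x i - (y + t • w) i| :=
    hmin ⟨fun i => (hco i).1, by simp [hAy, hAw]⟩
  simp only [Pi.add_apply, Pi.smul_apply, smul_eq_mul, (hco _).2, Finset.sum_sub_distrib,
    ← Finset.mul_sum] at hle
  have hsum : ∑ i, |w i| = 0 :=
    le_antisymm (by by_contra! h; nlinarith [mul_pos ht0 h])
      (Finset.sum_nonneg fun i _ => abs_nonneg _)
  funext i
  simpa using (Finset.sum_eq_zero_iff_of_nonneg fun i _ => abs_nonneg (w i)).1 hsum i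
    (Finset.mem_univ i)

theorem exists_isMinOn_sum_abs_sub {ι : Type*} [Fintype ι] (x : ι → ℝ) {s : Set (ι → ℝ)}
    (hs : IsClosed s) (hne : s.Nonempty) :
    ∃ y ∈ s, IsMinOn (fun y => ∑ i, |x i - y i|) s y := by
  obtain ⟨y₀, hy₀⟩ := hne
  refine ContinuousOn.exists_isMinOn' (by fun_prop) hs hy₀ (Eventually.filter_mono inf_le_left ?_)
  filter_upwards [(tendsto_norm_cocompact_atTop (E := ι → ℝ)).eventually_ge_atTop
    (∑ i, |x i - y₀ i| + ‖x‖)] with y hy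
  have h1 : ‖x - y‖ ≤ ∑ i, |x i - y i| :=
    (pi_norm_le_iff_of_nonneg (Finset.sum_nonneg fun i _ => abs_nonneg _)).2 fun i =>
      Finset.single_le_sum (f := fun i => |x i - y i|) (fun i _ => abs_nonneg _)
        (Finset.mem_univ i)
  have h2 := norm_sub_norm_le y x
  rw [norm_sub_rev] at h2
  linarith

/-- **Hoffman's error bound** for a polyhedron in standard form `{y ≥ 0, A y = b}`. -/
theorem hoffman_bound {ι : Type*} [Fintype ι] (A : (ι → ℝ) →L[ℝ] F) (b : F)
    (hne : ∃ y : ι → ℝ, (∀ i, 0 ≤ y i) ∧ A y = b) :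
    ∃ C : ℝ, 0 < C ∧ ∀ x : ι → ℝ, (∀ i, 0 ≤ x i) →
      ∃ y : ι → ℝ, (∀ i, 0 ≤ y i) ∧ A y = b ∧ ‖x - y‖ ≤ C * ‖A x - b‖ := by
  classical
  have hcone : ∀ σ : ι → SignType, ∃ C : ℝ, 0 < C ∧
      ((∀ u ∈ signCone σ, A u = 0 → u = 0) → ∀ u ∈ signCone σ, ‖u‖ ≤ C * ‖A u‖) := by
    intro σ
    by_cases h : ∀ u ∈ signCone σ, A u = 0 → u = 0
    · obtain ⟨C, hC, hCu⟩ := exists_norm_le_mul_norm_of_isClosed_cone A (isClosed_signCone σ)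
        (smul_mem_signCone σ) h
      exact ⟨C, hC, fun _ => hCu⟩
    · exact ⟨1, one_pos, fun h' => absurd h' h⟩
  choose C hC hCu using hcone
  refine ⟨∑ σ, C σ, Finset.sum_pos (fun σ _ => hC σ) Finset.univ_nonempty, fun x hx => ?_⟩
  have hclosed : IsClosed {y : ι → ℝ | (∀ i, 0 ≤ y i) ∧ A y = b} := by
    rw [Set.ofPred_and, Set.ofPred_forall]
    exact (isClosed_iInter fun i => isClosed_le continuous_const (continuous_apply i)).inter
      (isClosed_eq A.continuous continuous_const)
  obtain ⟨y, ⟨hy, hAy⟩, hmin⟩ := exists_isMinOn_sum_abs_sub x hclosed hne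
  refine ⟨y, hy, hAy, ?_⟩
  have := hCu (fun i => SignType.sign (x i - y i))
    (fun w hw hAw => eq_zero_of_mem_signCone_of_isMinOn A hx hy hAy hmin hw hAw) (x - y)
    (mem_signCone_sign (x - y))
  rw [map_sub, hAy] at this
  exact this.trans (mul_le_mul_of_nonneg_right
    (Finset.single_le_sum (fun σ _ => (hC σ).le) (Finset.mem_univ _)) (norm_nonneg _))

end HoffmanBound

namespace NLP

open Filter Topology

variable {n m : ℕ} (P : NLP n m) {zstar : Fin n → ℝ}

/-- The KKT residual at `(z, λ)`, measured in the sup norm. -/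
def residual (z : Fin n → ℝ) (lam : Fin m → ℝ) : ℝ :=
  ‖P.Lz z lam‖ + ‖fun i => min (lam i) (-(P.g i z))‖

theorem residual_nonneg (z : Fin n → ℝ) (lam : Fin m → ℝ) : 0 ≤ P.residual z lam :=
  add_nonneg (norm_nonneg _) (norm_nonneg _)

theorem Lz_eq (z : Fin n → ℝ) (lam : Fin m → ℝ) :
    P.Lz z lam = P.gradphi z + ∑ i, lam i • P.gradg i z := by
  funext j
  simp [Lz]

theorem Lz_sub_Lz (z z' : Fin n → ℝ) (lam lam' : Fin m → ℝ) :
    P.Lz z lam - P.Lz z' lam' = (P.gradphi z - P.gradphi z') +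
      ∑ i, lam i • (P.gradg i z - P.gradg i z') + ∑ i, (lam i - lam' i) • P.gradg i z' := by
  simp only [Lz_eq, smul_sub, sub_smul, Finset.sum_sub_distrib]
  abel

theorem mem_Slam_iff (hfeas : ∀ i, P.g i zstar ≤ 0) {lam : Fin m → ℝ} :
    lam ∈ P.Slam zstar ↔
      P.Lz zstar lam = 0 ∧ (∀ i, 0 ≤ lam i) ∧ ∀ i, P.g i zstar ≠ 0 → lam i = 0 := by
  constructor
  · rintro ⟨h1, -, h3, h4⟩
    refine ⟨h1, h3, fun i hi => ?_⟩
    have := (Finset.sum_eq_zero_iff_of_nonpos fun i _ =>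
      mul_nonpos_of_nonneg_of_nonpos (h3 i) (hfeas i)).1 h4 i (Finset.mem_univ i)
    exact (mul_eq_zero.1 this).resolve_right hi
  · rintro ⟨h1, h3, h4⟩
    refine ⟨h1, hfeas, h3, Finset.sum_eq_zero fun i _ => ?_⟩
    by_cases hi : P.g i zstar = 0
    · simp [hi]
    · simp [h4 i hi]

theorem min_eq_zero_of_mem_Slam {lam : Fin m → ℝ} (h : lam ∈ P.Slam zstar) (i : Fin m) :
    min (lam i) (-(P.g i zstar)) = 0 := by
  obtain ⟨-, h2, h3⟩ := (P.mem_Slam_iff h.2.1).1 h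
  by_cases hi : P.g i zstar = 0
  · simp [hi, h2 i]
  · simp [h3 i hi, h.2.1 i]

theorem isClosed_Slam : IsClosed (P.Slam zstar) := by
  have : P.Slam zstar = {lam | P.Lz zstar lam = 0} ∩ ({_lam | ∀ i, P.g i zstar ≤ 0} ∩
      ((⋂ i, {lam | 0 ≤ lam i}) ∩ {lam | ∑ i, lam i * P.g i zstar = 0})) := by
    ext lam
    simp [Slam, KKT]
  rw [this]
  have hcont : Continuous (P.Lz zstar) := by
    rw [funext (P.Lz_eq zstar)]
    fun_prop
  refine IsClosed.inter (isClosed_eq hcont continuous_const) (IsClosed.inter isClosed_const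
    (IsClosed.inter (isClosed_iInter fun i => isClosed_le continuous_const (continuous_apply i))
      (isClosed_eq (by fun_prop) continuous_const)))

theorem dotProduct_Lz_eq (z d : Fin n → ℝ) (lam : Fin m → ℝ) :
    P.Lz z lam ⬝ᵥ d = P.gradphi z ⬝ᵥ d + ∑ i, lam i * (P.gradg i z ⬝ᵥ d) := by
  rw [Lz_eq, add_dotProduct, sum_dotProduct]
  simp [smul_dotProduct]

/-- Under MFCQ the set of multipliers is compact. -/
theorem isCompact_Slam (hmfcq : P.MFCQ zstar) : IsCompact (P.Slam zstar) := by
  obtain ⟨y, hy⟩ := hmfcq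
  refine Metric.isCompact_of_isClosed_isBounded P.isClosed_Slam ?_
  set B : Fin m → ℝ := fun i => |(P.gradphi zstar ⬝ᵥ y) / (P.gradg i zstar ⬝ᵥ y)|
  refine (Metric.isBounded_Icc (0 : Fin m → ℝ) B).subset fun lam hlam => ?_
  obtain ⟨h1, h2, h3⟩ := (P.mem_Slam_iff hlam.2.1).1 hlam
  refine ⟨h2, fun i => ?_⟩
  by_cases hi : P.g i zstar = 0
  · have hyi : P.gradg i zstar ⬝ᵥ y < 0 := hy i hi
    have hterm : ∀ k ∈ Finset.univ, lam k * (P.gradg k zstar ⬝ᵥ y) ≤ 0 := fun k _ => by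
      by_cases hk : P.g k zstar = 0
      · exact mul_nonpos_of_nonneg_of_nonpos (h2 k) (hy k hk).le
      · simp [h3 k hk]
    have hsum := P.dotProduct_Lz_eq zstar y lam
    rw [h1, zero_dotProduct] at hsum
    have hle := Finset.sum_le_sum_of_subset_of_nonneg (Finset.subset_univ {i})
      (f := fun k => -(lam k * (P.gradg k zstar ⬝ᵥ y)))
      fun k hk _ => neg_nonneg.2 (hterm k hk)
    rw [Finset.sum_singleton, Finset.sum_neg_distrib] at hle
    simp only [B]
    rw [abs_div, abs_of_neg hyi, le_div_iff₀ (neg_pos.2 hyi)]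
    linarith [le_abs_self (P.gradphi zstar ⬝ᵥ y)]
  · rw [h3 i hi]
    exact abs_nonneg _

theorem exists_eventually_norm_sub_le (zstar : Fin n → ℝ) :
    ∃ C : ℝ, 0 < C ∧ ∀ᶠ z in 𝓝 zstar, ‖P.gradphi z - P.gradphi zstar‖ ≤ C * ‖z - zstar‖ ∧
      ∀ i, ‖P.gradg i z - P.gradg i zstar‖ ≤ C * ‖z - zstar‖ ∧
        ‖P.g i z - P.g i zstar‖ ≤ C * ‖z - zstar‖ := by
  obtain ⟨C₀, hC₀, h₀⟩ := (P.hess_phi zstar).isBigO_sub.exists_pos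
  choose C₁ hC₁ h₁ using fun i => (P.hess_g i zstar).isBigO_sub.exists_pos
  choose C₂ hC₂ h₂ using fun i => (P.grad_g i zstar).isBigO_sub.exists_pos
  have s₁ := fun i => Finset.single_le_sum (fun i _ => (hC₁ i).le) (Finset.mem_univ i)
  have s₂ := fun i => Finset.single_le_sum (fun i _ => (hC₂ i).le) (Finset.mem_univ i)
  have p₁ := Finset.sum_nonneg fun i (_ : i ∈ Finset.univ) => (hC₁ i).le
  have p₂ := Finset.sum_nonneg fun i (_ : i ∈ Finset.univ) => (hC₂ i).le
  refine ⟨C₀ + ∑ i, C₁ i + ∑ i, C₂ i, by linarith, ?_⟩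
  filter_upwards [h₀.bound, eventually_all.2 fun i => (h₁ i).bound,
    eventually_all.2 fun i => (h₂ i).bound] with z hz₀ hz₁ hz₂
  refine ⟨hz₀.trans ?_, fun i => ⟨(hz₁ i).trans ?_, (hz₂ i).trans ?_⟩⟩ <;> gcongr
  · linarith
  · linarith [s₁ i]
  · linarith [s₂ i]

theorem exists_eventually_norm_Lz_sub_le (zstar : Fin n → ℝ) (ls₀ : Fin m → ℝ) :
    ∃ C : ℝ, 0 < C ∧ ∀ᶠ p in 𝓝 (zstar, ls₀), ∀ ls : Fin m → ℝ,
      ‖P.Lz p.1 p.2 - P.Lz zstar ls‖ ≤ C * (‖p.1 - zstar‖ + ‖p.2 - ls‖) := by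
  obtain ⟨C, hC, h⟩ := P.exists_eventually_norm_sub_le zstar
  have hG : 0 ≤ ∑ i, ‖P.gradg i zstar‖ := Finset.sum_nonneg fun i _ => norm_nonneg _
  refine ⟨C + m * ((‖ls₀‖ + 1) * C) + ∑ i, ‖P.gradg i zstar‖, by positivity, ?_⟩
  have hbd : ∀ᶠ p : (Fin n → ℝ) × (Fin m → ℝ) in 𝓝 (zstar, ls₀), ‖p.2‖ < ‖ls₀‖ + 1 :=
    (continuous_snd.norm.tendsto (zstar, ls₀)).eventually_lt_const (lt_add_one _)
  filter_upwards [continuous_fst.continuousAt.eventually h, hbd] with p hp hR ls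
  rw [Lz_sub_Lz]
  have h1 : ‖∑ i, p.2 i • (P.gradg i p.1 - P.gradg i zstar)‖ ≤
      m * ((‖ls₀‖ + 1) * C) * ‖p.1 - zstar‖ := by
    refine (norm_sum_le_of_le Finset.univ (f := fun i => p.2 i • _)
      (n := fun _ => (‖ls₀‖ + 1) * C * ‖p.1 - zstar‖) fun i _ => ?_).trans_eq ?_
    · rw [norm_smul, mul_assoc]
      exact mul_le_mul ((norm_le_pi_norm p.2 i).trans hR.le) (hp.2 i).1 (norm_nonneg _)
        (by positivity)
    · simp [mul_assoc]
  have h2 : ‖∑ i, (p.2 i - ls i) • P.gradg i zstar‖ ≤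
      (∑ i, ‖P.gradg i zstar‖) * ‖p.2 - ls‖ := by
    rw [Finset.sum_mul]
    refine norm_sum_le_of_le _ fun i _ => ?_
    rw [norm_smul, mul_comm]
    exact mul_le_mul_of_nonneg_left (norm_le_pi_norm (p.2 - ls) i) (norm_nonneg _)
  refine (norm_add₃_le.trans (add_le_add (add_le_add hp.1 h1) h2)).trans ?_
  have e1 : 0 ≤ (C + m * ((‖ls₀‖ + 1) * C)) * ‖p.2 - ls‖ := by positivity
  have e2 : 0 ≤ (∑ i, ‖P.gradg i zstar‖) * ‖p.1 - zstar‖ := by positivity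
  linarith

/-- The residual is bounded by the distance to any primal-dual solution. -/
theorem exists_eventually_residual_le (zstar : Fin n → ℝ) (ls₀ : Fin m → ℝ) :
    ∃ C : ℝ, 0 < C ∧ ∀ᶠ p in 𝓝 (zstar, ls₀), ∀ ls ∈ P.Slam zstar,
      P.residual p.1 p.2 ≤ C * (‖p.1 - zstar‖ + ‖p.2 - ls‖) := by
  obtain ⟨C, hC, h⟩ := P.exists_eventually_norm_sub_le zstar
  obtain ⟨C', hC', h'⟩ := P.exists_eventually_norm_Lz_sub_le zstar ls₀
  refine ⟨C' + (C + 1), by positivity, ?_⟩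
  filter_upwards [continuous_fst.continuousAt.eventually h, h'] with p hp hp' ls hls
  have h1 := hp' ls
  rw [hls.1, sub_zero] at h1
  have h2 : ‖fun i => min (p.2 i) (-(P.g i p.1))‖ ≤ (C + 1) * (‖p.1 - zstar‖ + ‖p.2 - ls‖) := by
    refine (pi_norm_le_iff_of_nonneg (by positivity)).2 fun i => ?_
    have h3 := abs_min_sub_min_le_max (p.2 i) (-(P.g i p.1)) (ls i) (-(P.g i zstar))
    rw [P.min_eq_zero_of_mem_Slam hls, sub_zero] at h3
    have h4 : |p.2 i - ls i| ≤ ‖p.2 - ls‖ := norm_le_pi_norm (p.2 - ls) i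
    have h5 := (hp.2 i).2
    rw [Real.norm_eq_abs] at h5
    rw [neg_sub_neg, abs_sub_comm (P.g i zstar)] at h3
    have e1 := norm_nonneg (p.1 - zstar)
    have e2 := norm_nonneg (p.2 - ls)
    have e3 := mul_nonneg hC.le e1
    have e4 := mul_nonneg hC.le e2
    refine h3.trans (max_le ?_ ?_) <;> linarith
  rw [residual, add_mul]
  exact add_le_add h1 h2

/-- The multiplier part of the distance is bounded by the residual and the primal error. -/
theorem exists_eventually_multiplier_le {ls₀ : Fin m → ℝ}
    (hls₀ : ls₀ ∈ P.Slam zstar) :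
    ∃ C : ℝ, 0 < C ∧ ∀ᶠ p in 𝓝 (zstar, ls₀), (∀ i, 0 ≤ p.2 i) →
      ∃ ls ∈ P.Slam zstar, ‖p.2 - ls‖ ≤ C * (‖p.1 - zstar‖ + P.residual p.1 p.2) := by
  have hfeas := hls₀.2.1
  obtain ⟨C', hC', h'⟩ := P.exists_eventually_norm_Lz_sub_le zstar ls₀
  let A₁ : (Fin m → ℝ) →L[ℝ] (Fin n → ℝ) :=
    ∑ i, (ContinuousLinearMap.proj (R := ℝ) (φ := fun _ : Fin m => ℝ) i).smulRight
      (P.gradg i zstar)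
  let A₂ : (Fin m → ℝ) →L[ℝ] (Fin m → ℝ) := ContinuousLinearMap.pi fun i =>
    if P.g i zstar = 0 then 0 else ContinuousLinearMap.proj (R := ℝ) (φ := fun _ : Fin m => ℝ) i
  have hA₁ : ∀ lam, A₁ lam - -P.gradphi zstar = P.Lz zstar lam := fun lam => by
    simp [A₁, Lz_eq, add_comm]
  have hA₂ : ∀ lam i, A₂ lam i = if P.g i zstar = 0 then 0 else lam i := fun lam i => by
    by_cases hi : P.g i zstar = 0 <;> simp [A₂, hi]
  have hmem : ∀ lam, lam ∈ P.Slam zstar ↔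
      (∀ i, 0 ≤ lam i) ∧ (A₁.prod A₂) lam = (-P.gradphi zstar, 0) := fun lam => by
    rw [P.mem_Slam_iff hfeas, ← hA₁, sub_eq_zero, ContinuousLinearMap.prod_apply, Prod.mk_inj,
      funext_iff (f := A₂ lam)]
    simp only [hA₂, Pi.zero_apply, ite_eq_left_iff]
    tauto
  obtain ⟨C, hC, hoff⟩ := hoffman_bound (A₁.prod A₂) (-P.gradphi zstar, 0)
    ⟨ls₀, (hmem ls₀).1 hls₀⟩
  refine ⟨C * (C' + 1), by positivity, ?_⟩
  have hN : ∀ᶠ p in 𝓝 (zstar, ls₀), ∀ i, P.g i zstar ≠ 0 → p.2 i ≤ -(P.g i p.1) := by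
    refine eventually_all.2 fun i => ?_
    by_cases hi : P.g i zstar = 0
    · simp [hi]
    · have hlt : ls₀ i < -(P.g i zstar) := by
        rw [((P.mem_Slam_iff hfeas).1 hls₀).2.2 i hi]
        exact neg_pos.2 (lt_of_le_of_ne (hfeas i) hi)
      have c₁ : Tendsto (fun p : (Fin n → ℝ) × (Fin m → ℝ) => p.2 i) (𝓝 (zstar, ls₀))
          (𝓝 (ls₀ i)) := ((continuous_apply i).comp continuous_snd).tendsto (zstar, ls₀)
      have c₂ : Tendsto (fun p : (Fin n → ℝ) × (Fin m → ℝ) => -(P.g i p.1)) (𝓝 (zstar, ls₀))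
          (𝓝 (-(P.g i zstar))) :=
        ((P.grad_g i zstar).continuousAt.tendsto.comp (continuous_fst.tendsto (zstar, ls₀))).neg
      exact (c₁.eventually_lt c₂ hlt).mono fun p hp _ => hp.le
  filter_upwards [h', hN] with p hp hpN hp0
  obtain ⟨ls, hls0, hlsA, hle⟩ := hoff p.2 hp0
  refine ⟨ls, (hmem ls).2 ⟨hls0, hlsA⟩, hle.trans ?_⟩
  rw [mul_assoc]
  refine mul_le_mul_of_nonneg_left ?_ hC.le
  rw [ContinuousLinearMap.prod_apply, Prod.mk_sub_mk, hA₁, sub_zero, Prod.norm_mk]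
  have e1 := norm_nonneg (p.1 - zstar)
  have e2 := P.residual_nonneg p.1 p.2
  have e3 := mul_nonneg hC'.le e1
  have e4 := mul_nonneg hC'.le e2
  have hL : ‖P.Lz p.1 p.2‖ ≤ P.residual p.1 p.2 := le_add_of_nonneg_right (norm_nonneg _)
  have hM : ‖fun i => min (p.2 i) (-(P.g i p.1))‖ ≤ P.residual p.1 p.2 :=
    le_add_of_nonneg_left (norm_nonneg _)
  refine max_le ?_ ((pi_norm_le_iff_of_nonneg (by nlinarith)).2 fun i => ?_)
  · have h1 := hp p.2
    have h2 := norm_sub_norm_le (P.Lz zstar p.2) (P.Lz p.1 p.2)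
    rw [sub_self, norm_zero, add_zero] at h1
    rw [norm_sub_rev] at h2
    linarith
  · rw [hA₂]
    by_cases hi : P.g i zstar = 0
    · simp only [hi, if_true, norm_zero]
      nlinarith
    · have h1 := norm_le_pi_norm (fun i => min (p.2 i) (-(P.g i p.1))) i
      simp only [min_eq_left (hpN i hi)] at h1
      simp only [hi, if_false]
      linarith


/-- The second-order condition excludes nonzero directions `d` that solve the linearized
KKT system together with some multiplier direction `μ`. -/
theorem eq_zero_of_linearized (hsoc : P.SOC zstar) {ls₀ : Fin m → ℝ}
    (hls₀ : ls₀ ∈ P.Slam zstar) {d : Fin n → ℝ} {μ : Fin m → ℝ}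
    (hstat : P.Lzz zstar ls₀ *ᵥ d + ∑ i, μ i • P.gradg i zstar = 0)
    (hB : ∀ i, P.g i zstar = 0 → P.gradg i zstar ⬝ᵥ d ≤ 0)
    (hneg : ∀ i, P.g i zstar = 0 → P.gradg i zstar ⬝ᵥ d < 0 → ls₀ i = 0 ∧ μ i ≤ 0)
    (hN : ∀ i, P.g i zstar ≠ 0 → μ i = 0) : d = 0 := by
  obtain ⟨ξ, hξ, hsoc⟩ := hsoc
  have hfeas := hls₀.2.1
  have hzero : ∀ i, ls₀ i * (P.gradg i zstar ⬝ᵥ d) = 0 := fun i => by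
    by_cases hi : P.g i zstar = 0
    · rcases (hB i hi).lt_or_eq with h | h
      · simp [(hneg i hi h).1]
      · simp [h]
    · simp [((P.mem_Slam_iff hfeas).1 hls₀).2.2 i hi]
  have hphi : P.gradphi zstar ⬝ᵥ d = 0 := by
    have := P.dotProduct_Lz_eq zstar d ls₀
    simpa [hls₀.1, hzero] using this.symm
  have hplus : ∀ i, i ∈ P.BPlus zstar → P.gradg i zstar ⬝ᵥ d = 0 := by
    rintro i ⟨hi, ls, hls, hpos⟩
    obtain ⟨h1, h2, h3⟩ := (P.mem_Slam_iff hfeas).1 hls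
    have hsum := P.dotProduct_Lz_eq zstar d ls
    rw [h1, zero_dotProduct, hphi, zero_add] at hsum
    have := (Finset.sum_eq_zero_iff_of_nonpos fun k _ => ?_).1 hsum.symm i (Finset.mem_univ i)
    · exact (mul_eq_zero.1 this).resolve_left hpos.ne'
    · by_cases hk : P.g k zstar = 0
      · exact mul_nonpos_of_nonneg_of_nonpos (h2 k) (hB k hk)
      · simp [h3 k hk]
  have hquad := hsoc ls₀ hls₀ d hplus fun i hi _ => hB i hi
  have hdot : d ⬝ᵥ P.Lzz zstar ls₀ *ᵥ d + ∑ i, μ i * (P.gradg i zstar ⬝ᵥ d) = 0 := by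
    have := congrArg (fun v => d ⬝ᵥ v) hstat
    simpa [dotProduct_add, dotProduct_comm d, sum_dotProduct, smul_dotProduct] using this
  have hnonneg : 0 ≤ ∑ i, μ i * (P.gradg i zstar ⬝ᵥ d) := Finset.sum_nonneg fun i _ => by
    by_cases hi : P.g i zstar = 0
    · rcases (hB i hi).lt_or_eq with h | h
      · exact mul_nonneg_of_nonpos_of_nonpos (hneg i hi h).2 h.le
      · simp [h]
    · simp [hN i hi]
  have hsq : evnorm d ^ 2 = ∑ i, d i ^ 2 :=
    Real.sq_sqrt (Finset.sum_nonneg fun i _ => sq_nonneg (d i))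
  have hle : ∑ i, d i ^ 2 ≤ 0 := by
    by_contra! h
    rw [hsq] at hquad
    linarith [mul_pos hξ h]
  funext i
  simpa using (Finset.sum_eq_zero_iff_of_nonneg fun i _ => sq_nonneg (d i)).1
    (le_antisymm hle (Finset.sum_nonneg fun i _ => sq_nonneg (d i))) i (Finset.mem_univ i)

theorem dotCLM_apply (v x : Fin n → ℝ) : dotCLM v x = v ⬝ᵥ x := by
  simp [dotCLM, dotProduct]

theorem matCLM_apply (M : Matrix (Fin n) (Fin n) ℝ) (x : Fin n → ℝ) : matCLM M x = M *ᵥ x := rfl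

/-- Difference quotients along a sequence whose normalized increments converge. -/
theorem tendsto_smul_sub_of_hasFDerivAt {α E F : Type*} [NormedAddCommGroup E] [NormedSpace ℝ E]
    [NormedAddCommGroup F] [NormedSpace ℝ F] {f : E → F} {f' : E →L[ℝ] F} {x v : E}
    (hf : HasFDerivAt f f' x) {l : Filter α} {c : α → ℝ} {z : α → E} (hz : Tendsto z l (𝓝 x))
    (hv : Tendsto (fun k => c k • (z k - x)) l (𝓝 v)) :
    Tendsto (fun k => c k • (f (z k) - f x)) l (𝓝 (f' v)) := by
  have hlim := (hasFDerivWithinAt_univ.2 hf).lim (l := l) (c := c) (d := fun k => z k - x)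
    (by simpa using hz.sub_const x) (.of_forall fun _ => Set.mem_univ _) hv
  simpa using hlim

/-- The limit along a filter of normalized KKT increments with vanishing relative residual
satisfies the linearized KKT system. -/
theorem linearized_of_tendsto {α : Type*} {l : Filter α} [l.NeBot] {ls₀ : Fin m → ℝ}
    (hls₀ : ls₀ ∈ P.Slam zstar) {z : α → Fin n → ℝ} {lam ls : α → Fin m → ℝ} {τ : α → ℝ}
    {d : Fin n → ℝ} {μ : Fin m → ℝ} (hτ : ∀ k, 0 < τ k) (hτ0 : Tendsto τ l (𝓝 0))
    (hz : Tendsto z l (𝓝 zstar)) (hlam : Tendsto lam l (𝓝 ls₀)) (hls : ∀ k, ls k ∈ P.Slam zstar)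
    (hd : Tendsto (fun k => (τ k)⁻¹ • (z k - zstar)) l (𝓝 d))
    (hμ : Tendsto (fun k => (τ k)⁻¹ • (lam k - ls k)) l (𝓝 μ))
    (hres : Tendsto (fun k => (τ k)⁻¹ * P.residual (z k) (lam k)) l (𝓝 0)) :
    P.Lzz zstar ls₀ *ᵥ d + ∑ i, μ i • P.gradg i zstar = 0 ∧
    (∀ i, P.g i zstar = 0 → P.gradg i zstar ⬝ᵥ d ≤ 0) ∧
    (∀ i, P.g i zstar = 0 → P.gradg i zstar ⬝ᵥ d < 0 → ls₀ i = 0 ∧ μ i ≤ 0) ∧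
    ∀ i, P.g i zstar ≠ 0 → μ i = 0 := by
  have hfeas := hls₀.2.1
  have hτinv : ∀ k, 0 ≤ (τ k)⁻¹ := fun k => (inv_pos.2 (hτ k)).le
  have hlami : ∀ i, Tendsto (fun k => lam k i) l (𝓝 (ls₀ i)) := fun i =>
    (tendsto_pi_nhds.1 hlam) i
  have hμi : ∀ i, Tendsto (fun k => (τ k)⁻¹ * (lam k i - ls k i)) l (𝓝 (μ i)) := fun i =>
    (tendsto_pi_nhds.1 hμ) i
  have hgi : ∀ i, Tendsto (fun k => (τ k)⁻¹ * (P.g i (z k) - P.g i zstar)) l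
      (𝓝 (P.gradg i zstar ⬝ᵥ d)) := fun i => by
    simpa [dotCLM_apply] using tendsto_smul_sub_of_hasFDerivAt (P.grad_g i zstar) hz hd
  have hL : Tendsto (fun k => (τ k)⁻¹ • P.Lz (z k) (lam k)) l (𝓝 0) := by
    refine squeeze_zero_norm (fun k => ?_) hres
    rw [norm_smul, Real.norm_of_nonneg (hτinv k)]
    exact mul_le_mul_of_nonneg_left (le_add_of_nonneg_right (norm_nonneg _)) (hτinv k)
  have hmin : ∀ i, Tendsto (fun k => (τ k)⁻¹ * min (lam k i) (-(P.g i (z k)))) l (𝓝 0) :=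
    fun i => by
    refine squeeze_zero_norm (fun k => ?_) hres
    rw [norm_mul, Real.norm_of_nonneg (hτinv k)]
    exact mul_le_mul_of_nonneg_left ((norm_le_pi_norm
      (fun i => min (lam k i) (-(P.g i (z k)))) i).trans
      (le_add_of_nonneg_left (norm_nonneg _))) (hτinv k)
  have hquot : ∀ i, Tendsto (fun k => (τ k)⁻¹ * lam k i) l (𝓝 0) → ls₀ i = 0 := fun i h => by
    refine tendsto_nhds_unique (hlami i) ?_
    have := hτ0.mul h
    rw [zero_mul] at this
    exact this.congr fun k => mul_inv_cancel_left₀ (hτ k).ne' _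
  refine ⟨?_, fun i hi => ?_, fun i hi hlt => ?_, fun i hi => ?_⟩
  · refine tendsto_nhds_unique ?_ hL
    have h1 := tendsto_smul_sub_of_hasFDerivAt (P.hess_phi zstar) hz hd
    have h2 := tendsto_finsetSum Finset.univ fun i _ =>
      (hlami i).smul (tendsto_smul_sub_of_hasFDerivAt (P.hess_g i zstar) hz hd)
    have h3 := tendsto_finsetSum Finset.univ fun i _ =>
      (hμi i).smul_const (P.gradg i zstar)
    have hlim : P.Lzz zstar ls₀ *ᵥ d =
        matCLM (P.hessphi zstar) d + ∑ i, ls₀ i • matCLM (P.hessg i zstar) d := by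
      simp [Lzz, matCLM_apply, add_mulVec, sum_mulVec, smul_mulVec]
    rw [hlim]
    refine ((h1.add h2).add h3).congr fun k => ?_
    have hk := P.Lz_sub_Lz (z k) zstar (lam k) (ls k)
    rw [(hls k).1, sub_zero] at hk
    rw [hk]
    simp only [smul_add, Finset.smul_sum, mul_smul, smul_comm (lam k _)]
  · have h1 : Tendsto (fun k => (τ k)⁻¹ * -(P.g i (z k))) l (𝓝 (-(P.gradg i zstar ⬝ᵥ d))) := by
      simpa [hi] using (hgi i).neg
    have := le_of_tendsto_of_tendsto' (hmin i) h1 fun k =>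
      mul_le_mul_of_nonneg_left (min_le_right _ _) (hτinv k)
    linarith
  · have h1 : Tendsto (fun k => (τ k)⁻¹ * -(P.g i (z k))) l (𝓝 (-(P.gradg i zstar ⬝ᵥ d))) := by
      simpa [hi] using (hgi i).neg
    have hev := (hmin i).eventually_lt h1 (neg_pos.2 hlt)
    have h0 : Tendsto (fun k => (τ k)⁻¹ * lam k i) l (𝓝 0) := by
      refine (hmin i).congr' (hev.mono fun k hk => ?_)
      have := lt_of_mul_lt_mul_left hk (hτinv k)
      rw [min_eq_left ((min_lt_iff.1 this).resolve_right (lt_irrefl _)).le]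
    exact ⟨hquot i h0, le_of_tendsto_of_tendsto' (hμi i) h0 fun k =>
      mul_le_mul_of_nonneg_left (sub_le_self _ ((hls k).2.2.1 i)) (hτinv k)⟩
  · have hlt : ls₀ i < -(P.g i zstar) := by
      rw [((P.mem_Slam_iff hfeas).1 hls₀).2.2 i hi]
      exact neg_pos.2 (lt_of_le_of_ne (hfeas i) hi)
    have hev := (hlami i).eventually_lt ((P.grad_g i zstar).continuousAt.tendsto.comp hz).neg hlt
    refine tendsto_nhds_unique (hμi i) ((hmin i).congr' (hev.mono fun k hk => ?_))
    have hk : lam k i < -(P.g i (z k)) := hk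
    simp only [min_eq_left hk.le, ((P.mem_Slam_iff hfeas).1 (hls k)).2.2 i hi, sub_zero]

/-- The primal error is bounded by the residual near a primal-dual solution. -/
theorem exists_eventually_primal_le (hsoc : P.SOC zstar) {ls₀ : Fin m → ℝ}
    (hls₀ : ls₀ ∈ P.Slam zstar) :
    ∃ C : ℝ, 0 < C ∧ ∀ᶠ p in 𝓝 (zstar, ls₀), (∀ i, 0 ≤ p.2 i) →
      ‖p.1 - zstar‖ ≤ C * P.residual p.1 p.2 := by
  by_contra! hcon
  obtain ⟨C, hC, hmult⟩ := P.exists_eventually_multiplier_le hls₀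
  have hseq : ∀ k : ℕ, ∃ p : (Fin n → ℝ) × (Fin m → ℝ), dist p (zstar, ls₀) < 1 / ((k : ℝ) + 1) ∧
      (∃ ls ∈ P.Slam zstar, ‖p.2 - ls‖ ≤ C * (‖p.1 - zstar‖ + P.residual p.1 p.2)) ∧
      ((k : ℝ) + 1) * P.residual p.1 p.2 < ‖p.1 - zstar‖ := by
    intro k
    have hk : (0 : ℝ) < (k : ℝ) + 1 := by positivity
    have hfreq := hcon _ hk
    obtain ⟨p, hp, hp1, hp2⟩ := (hfreq.and_eventually (hmult.and
      (Metric.ball_mem_nhds (zstar, ls₀) (one_div_pos.2 hk)))).exists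
    exact ⟨p, hp2, hp1 hp.1, hp.2⟩
  choose p hp hex hlt using hseq
  choose ls hls hle using hex
  set τ : ℕ → ℝ := fun k => ‖(p k).1 - zstar‖
  have hr := fun k => P.residual_nonneg (p k).1 (p k).2
  have hτ : ∀ k, 0 < τ k := fun k => lt_of_le_of_lt (mul_nonneg (by positivity) (hr k)) (hlt k)
  set U : Ultrafilter ℕ := hyperfilter ℕ
  have hU : (U : Filter ℕ) ≤ atTop := Nat.hyperfilter_le_atTop
  have hone : Tendsto (fun k : ℕ => 1 / ((k : ℝ) + 1)) U (𝓝 0) :=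
    tendsto_one_div_add_atTop_nhds_zero_nat.mono_left hU
  have hptend : Tendsto p U (𝓝 (zstar, ls₀)) :=
    tendsto_iff_dist_tendsto_zero.2 (squeeze_zero (fun _ => dist_nonneg) (fun k => (hp k).le) hone)
  have hz : Tendsto (fun k => (p k).1) U (𝓝 zstar) := (continuous_fst.tendsto _).comp hptend
  have hlam : Tendsto (fun k => (p k).2) U (𝓝 ls₀) := (continuous_snd.tendsto _).comp hptend
  have hτ0 : Tendsto τ U (𝓝 0) := tendsto_iff_norm_sub_tendsto_zero.1 hz
  have hrel : ∀ k, (τ k)⁻¹ * P.residual (p k).1 (p k).2 ≤ 1 / ((k : ℝ) + 1) := fun k => by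
    rw [← div_eq_inv_mul, div_le_div_iff₀ (hτ k) (by positivity), one_mul, mul_comm]
    exact (hlt k).le
  have hres : Tendsto (fun k => (τ k)⁻¹ * P.residual (p k).1 (p k).2) U (𝓝 0) :=
    squeeze_zero (fun k => mul_nonneg (inv_pos.2 (hτ k)).le (hr k)) hrel hone
  have hdnorm : ∀ k, ‖(τ k)⁻¹ • ((p k).1 - zstar)‖ = 1 := fun k => by
    rw [norm_smul, norm_inv, Real.norm_of_nonneg (hτ k).le]
    exact inv_mul_cancel₀ (hτ k).ne'
  have hμnorm : ∀ k, ‖(τ k)⁻¹ • ((p k).2 - ls k)‖ ≤ C * 2 := fun k => by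
    rw [norm_smul, norm_inv, Real.norm_of_nonneg (hτ k).le, ← div_eq_inv_mul, div_le_iff₀ (hτ k),
      mul_assoc]
    refine (hle k).trans (mul_le_mul_of_nonneg_left ?_ hC.le)
    have h1 : P.residual (p k).1 (p k).2 ≤ ((k : ℝ) + 1) * P.residual (p k).1 (p k).2 :=
      le_mul_of_one_le_left (hr k) (by simp)
    have h2 := hlt k
    simp only [τ]
    linarith
  obtain ⟨d, hd1, hd⟩ := (isCompact_sphere (0 : Fin n → ℝ) 1).ultrafilter_le_nhds
    (U.map fun k => (τ k)⁻¹ • ((p k).1 - zstar)) (by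
      rw [Ultrafilter.coe_map, le_principal_iff, mem_map]
      exact univ_mem' fun k => by simpa using hdnorm k)
  obtain ⟨μ, -, hμ⟩ := (isCompact_closedBall (0 : Fin m → ℝ) (C * 2)).ultrafilter_le_nhds
    (U.map fun k => (τ k)⁻¹ • ((p k).2 - ls k)) (by
      rw [Ultrafilter.coe_map, le_principal_iff, mem_map]
      exact univ_mem' fun k => by simpa using hμnorm k)
  obtain ⟨h1, h2, h3, h4⟩ := P.linearized_of_tendsto hls₀ hτ hτ0 hz hlam hls hd hμ hres
  have hd0 := P.eq_zero_of_linearized hsoc hls₀ h1 h2 h3 h4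
  simp [hd0] at hd1

/-- The distance to the solution set is bounded by the residual near a primal-dual solution. -/
theorem exists_eventually_distance_le (hsoc : P.SOC zstar) {ls₀ : Fin m → ℝ}
    (hls₀ : ls₀ ∈ P.Slam zstar) :
    ∃ C : ℝ, 0 < C ∧ ∀ᶠ p in 𝓝 (zstar, ls₀), (∀ i, 0 ≤ p.2 i) →
      ∃ ls ∈ P.Slam zstar, ‖p.1 - zstar‖ + ‖p.2 - ls‖ ≤ C * P.residual p.1 p.2 := by
  obtain ⟨C₁, hC₁, h₁⟩ := P.exists_eventually_multiplier_le hls₀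
  obtain ⟨C₂, hC₂, h₂⟩ := P.exists_eventually_primal_le hsoc hls₀
  refine ⟨C₂ + C₁ * (C₂ + 1), by positivity, ?_⟩
  filter_upwards [h₁, h₂] with p hp₁ hp₂ hp0
  obtain ⟨ls, hls, hle⟩ := hp₁ hp0
  refine ⟨ls, hls, ?_⟩
  have h3 := hp₂ hp0
  have h4 := mul_le_mul_of_nonneg_left h3 hC₁.le
  linarith

/-- The residual in the Euclidean norm. -/
def euclideanResidual (z : Fin n → ℝ) (lam : Fin m → ℝ) : ℝ :=
  Real.sqrt (evnorm (P.Lz z lam) ^ 2 + evnorm (fun i => min (lam i) (-(P.g i z))) ^ 2)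

theorem euclideanResidual_nonneg (z : Fin n → ℝ) (lam : Fin m → ℝ) :
    0 ≤ P.euclideanResidual z lam :=
  Real.sqrt_nonneg _

end NLP

section NormComparison

theorem evnorm_nonneg {ι : Type*} [Fintype ι] (v : ι → ℝ) : 0 ≤ evnorm v := Real.sqrt_nonneg _

theorem norm_le_evnorm {ι : Type*} [Fintype ι] (v : ι → ℝ) : ‖v‖ ≤ evnorm v :=
  (pi_norm_le_iff_of_nonneg (evnorm_nonneg v)).2 fun i => Real.abs_le_sqrt
    (Finset.single_le_sum (f := fun i => v i ^ 2) (fun i _ => sq_nonneg (v i)) (Finset.mem_univ i))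

theorem evnorm_le_card_mul_norm {ι : Type*} [Fintype ι] (v : ι → ℝ) :
    evnorm v ≤ ((Fintype.card ι : ℝ) + 1) * ‖v‖ := by
  refine Real.sqrt_le_iff.2 ⟨by positivity, ?_⟩
  have h : ∑ i, v i ^ 2 ≤ ∑ _i : ι, ‖v‖ ^ 2 := Finset.sum_le_sum fun i _ =>
    sq_le_sq' (abs_le.1 (norm_le_pi_norm v i)).1 (abs_le.1 (norm_le_pi_norm v i)).2
  rw [Finset.sum_const, Finset.card_univ, nsmul_eq_mul] at h
  refine h.trans ?_
  rw [mul_pow]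
  have hc : (0 : ℝ) ≤ Fintype.card ι := Nat.cast_nonneg _
  exact mul_le_mul_of_nonneg_right (by nlinarith) (sq_nonneg _)

theorem norm_add_norm_le_sqrt {ι κ : Type*} [Fintype ι] [Fintype κ] (v : ι → ℝ) (w : κ → ℝ) :
    ‖v‖ + ‖w‖ ≤ 2 * Real.sqrt (evnorm v ^ 2 + evnorm w ^ 2) := by
  have h1 := (norm_le_evnorm v).trans
    (Real.le_sqrt_of_sq_le (le_add_of_nonneg_right (sq_nonneg (evnorm w))))
  have h2 := (norm_le_evnorm w).trans
    (Real.le_sqrt_of_sq_le (le_add_of_nonneg_left (sq_nonneg (evnorm v))))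
  linarith

theorem sqrt_le_norm_add_norm {ι κ : Type*} [Fintype ι] [Fintype κ] (v : ι → ℝ) (w : κ → ℝ) :
    Real.sqrt (evnorm v ^ 2 + evnorm w ^ 2) ≤
      ((Fintype.card ι : ℝ) + Fintype.card κ + 1) * (‖v‖ + ‖w‖) := by
  have h : Real.sqrt (evnorm v ^ 2 + evnorm w ^ 2) ≤ evnorm v + evnorm w := by
    refine Real.sqrt_le_iff.2 ⟨add_nonneg (evnorm_nonneg v) (evnorm_nonneg w), ?_⟩
    nlinarith [mul_nonneg (evnorm_nonneg v) (evnorm_nonneg w)]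
  have h1 := evnorm_le_card_mul_norm v
  have h2 := evnorm_le_card_mul_norm w
  have h3 : 0 ≤ (Fintype.card κ : ℝ) * ‖v‖ := by positivity
  have h4 : 0 ≤ (Fintype.card ι : ℝ) * ‖w‖ := by positivity
  linarith

end NormComparison

namespace NLP

open Filter Topology

variable {n m : ℕ} (P : NLP n m) {zstar : Fin n → ℝ}

/-- The two-sided estimate near a single primal-dual solution. -/
theorem exists_eventually_delta_estimate (hsoc : P.SOC zstar) {ls₀ : Fin m → ℝ}
    (hls₀ : ls₀ ∈ P.Slam zstar) :
    ∃ C : ℝ, 0 < C ∧ ∀ᶠ p in 𝓝 (zstar, ls₀), (∀ i, 0 ≤ p.2 i) →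
      P.euclideanResidual p.1 p.2 ≤ C * P.delta zstar p.1 p.2 ∧
      P.delta zstar p.1 p.2 ≤ C * P.euclideanResidual p.1 p.2 := by
  obtain ⟨C₁, hC₁, h₁⟩ := P.exists_eventually_residual_le zstar ls₀
  obtain ⟨C₂, hC₂, h₂⟩ := P.exists_eventually_distance_le hsoc hls₀
  set K : ℝ := (n : ℝ) + m + 1
  have hK : 0 < K := by positivity
  have hcard : ((Fintype.card (Fin n) : ℝ) + Fintype.card (Fin m) + 1) = K := by simp [K]
  refine ⟨K * (C₁ * 2) + K * (C₂ * 2), by positivity, ?_⟩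
  filter_upwards [h₁, h₂] with p hp₁ hp₂ hp0
  constructor
  · have hpos : 0 < K * (C₁ * 2) + K * (C₂ * 2) := by positivity
    rw [← div_le_iff₀' hpos]
    refine le_csInf ⟨_, ls₀, hls₀, rfl⟩ ?_
    rintro _ ⟨ls, hls, rfl⟩
    rw [div_le_iff₀' hpos]
    have e1 : P.euclideanResidual p.1 p.2 ≤ K * P.residual p.1 p.2 := by
      rw [← hcard]
      exact sqrt_le_norm_add_norm _ _
    have e2 := mul_le_mul_of_nonneg_left (hp₁ ls hls) hK.le
    have e3 := mul_le_mul_of_nonneg_left (norm_add_norm_le_sqrt (p.1 - zstar) (p.2 - ls))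
      (mul_pos hK hC₁).le
    have e4 : 0 ≤ K * (C₂ * 2) * √(evnorm (p.1 - zstar) ^ 2 + evnorm (p.2 - ls) ^ 2) := by
      positivity
    linarith
  · obtain ⟨ls, hls, hle⟩ := hp₂ hp0
    have e0 : P.delta zstar p.1 p.2 ≤ √(evnorm (p.1 - zstar) ^ 2 + evnorm (p.2 - ls) ^ 2) := by
      refine csInf_le ⟨0, ?_⟩ ⟨ls, hls, rfl⟩
      rintro _ ⟨_, -, rfl⟩
      exact Real.sqrt_nonneg _
    have e1 := sqrt_le_norm_add_norm (p.1 - zstar) (p.2 - ls)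
    rw [hcard] at e1
    have e2 := mul_le_mul_of_nonneg_left hle hK.le
    have e3 : P.residual p.1 p.2 ≤ 2 * P.euclideanResidual p.1 p.2 := norm_add_norm_le_sqrt _ _
    have e4 := mul_le_mul_of_nonneg_left e3 (mul_pos hK hC₂).le
    have e5 : 0 ≤ K * (C₁ * 2) * P.euclideanResidual p.1 p.2 :=
      mul_nonneg (by positivity) (P.euclideanResidual_nonneg _ _)
    linarith

theorem delta_nonneg (z : Fin n → ℝ) (lam : Fin m → ℝ) : 0 ≤ P.delta zstar z lam := by
  refine Real.sInf_nonneg ?_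
  rintro _ ⟨_, -, rfl⟩
  exact Real.sqrt_nonneg _

/-- The two-sided estimate holds with a uniform constant on a neighborhood of the solution set. -/
theorem exists_isOpen_delta_estimate (hmfcq : P.MFCQ zstar) (hsoc : P.SOC zstar) :
    ∃ C : ℝ, 0 < C ∧ ∃ W : Set ((Fin n → ℝ) × (Fin m → ℝ)), IsOpen W ∧
      (∀ ls ∈ P.Slam zstar, (zstar, ls) ∈ W) ∧ ∀ p ∈ W, (∀ i, 0 ≤ p.2 i) →
        P.euclideanResidual p.1 p.2 ≤ C * P.delta zstar p.1 p.2 ∧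
        P.delta zstar p.1 p.2 ≤ C * P.euclideanResidual p.1 p.2 := by
  refine (P.isCompact_Slam hmfcq).induction_on
    (p := fun s => ∃ C : ℝ, 0 < C ∧ ∃ W : Set ((Fin n → ℝ) × (Fin m → ℝ)), IsOpen W ∧
      (∀ ls ∈ s, (zstar, ls) ∈ W) ∧ ∀ p ∈ W, (∀ i, 0 ≤ p.2 i) →
        P.euclideanResidual p.1 p.2 ≤ C * P.delta zstar p.1 p.2 ∧
        P.delta zstar p.1 p.2 ≤ C * P.euclideanResidual p.1 p.2) ?_ ?_ ?_ ?_
  · exact ⟨1, one_pos, ∅, isOpen_empty, by simp, by simp⟩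
  · rintro s t hst ⟨C, hC, W, hW, hmem, h⟩
    exact ⟨C, hC, W, hW, fun ls hls => hmem ls (hst hls), h⟩
  · rintro s t ⟨C₁, hC₁, W₁, hW₁, hmem₁, h₁⟩ ⟨C₂, hC₂, W₂, hW₂, hmem₂, h₂⟩
    refine ⟨max C₁ C₂, lt_max_of_lt_left hC₁, W₁ ∪ W₂, hW₁.union hW₂,
      fun ls hls => hls.imp (hmem₁ ls) (hmem₂ ls), fun p hp hp0 => ?_⟩
    have weaken : ∀ C ≤ max C₁ C₂,
        P.euclideanResidual p.1 p.2 ≤ C * P.delta zstar p.1 p.2 ∧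
        P.delta zstar p.1 p.2 ≤ C * P.euclideanResidual p.1 p.2 →
        P.euclideanResidual p.1 p.2 ≤ max C₁ C₂ * P.delta zstar p.1 p.2 ∧
        P.delta zstar p.1 p.2 ≤ max C₁ C₂ * P.euclideanResidual p.1 p.2 := fun C hC h =>
      ⟨h.1.trans (mul_le_mul_of_nonneg_right hC (P.delta_nonneg _ _)),
        h.2.trans (mul_le_mul_of_nonneg_right hC (P.euclideanResidual_nonneg _ _))⟩
    rcases hp with hp | hp
    · exact weaken C₁ (le_max_left _ _) (h₁ p hp hp0)
    · exact weaken C₂ (le_max_right _ _) (h₂ p hp hp0)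
  · intro ls₀ hls₀
    obtain ⟨C, hC, hev⟩ := P.exists_eventually_delta_estimate hsoc hls₀
    obtain ⟨W, hW, hWo, hmem⟩ := eventually_nhds_iff.1 hev
    have hcont : Continuous fun ls : Fin m → ℝ => (zstar, ls) := by fun_prop
    exact ⟨(fun ls => (zstar, ls)) ⁻¹' W,
      mem_nhdsWithin_of_mem_nhds ((hWo.preimage hcont).mem_nhds hmem),
      C, hC, W, hWo, fun _ h => h, hW⟩

end NLP

/-- Suppose the KKT conditions are satisfied at `z = z*`, and that
MFCQ and the second-order condition hold at `z*`.  Then there exist constants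
`c₂ ≥ c₁ > 0` and a neighborhood `W` of the solution set `S` such that for all
`(z,λ) ∈ W` with `λ ≥ 0`,  `c₁·η(z,λ) ≤ δ(z,λ) ≤ c₂·η(z,λ)`, where
`η(z,λ) = ‖(L_z(z,λ), min(λ, −g(z)))‖` (the minimum taken componentwise). -/
theorem stmt1_distance_estimate
    {n m : ℕ} (P : NLP n m) (zstar : Fin n → ℝ)
    (hkkt : ∃ lam, P.KKT zstar lam)
    (hmfcq : P.MFCQ zstar)
    (hsoc : P.SOC zstar) :
    ∃ c₁ c₂ : ℝ, 0 < c₁ ∧ c₁ ≤ c₂ ∧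
      ∃ W : Set ((Fin n → ℝ) × (Fin m → ℝ)), IsOpen W ∧
        (∀ ls ∈ P.Slam zstar, (zstar, ls) ∈ W) ∧
        ∀ z : Fin n → ℝ, ∀ lam : Fin m → ℝ, (z, lam) ∈ W → (∀ i, 0 ≤ lam i) →
          c₁ * Real.sqrt (evnorm (P.Lz z lam) ^ 2 +
              evnorm (fun i => min (lam i) (-(P.g i z))) ^ 2) ≤ P.delta zstar z lam ∧
          P.delta zstar z lam ≤
            c₂ * Real.sqrt (evnorm (P.Lz z lam) ^ 2 +
              evnorm (fun i => min (lam i) (-(P.g i z))) ^ 2) := by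
  obtain ⟨C, hC, W, hW, hmem, h⟩ := P.exists_isOpen_delta_estimate hmfcq hsoc
  have hmax : (0 : ℝ) < max C 1 := lt_max_of_lt_left hC
  refine ⟨(max C 1)⁻¹, max C 1, inv_pos.2 hmax,
    (inv_le_one_of_one_le₀ (le_max_right C 1)).trans (le_max_right C 1), W, hW, hmem,
    fun z lam hp hp0 => ?_⟩
  obtain ⟨h1, h2⟩ := h (z, lam) hp hp0
  constructor
  · rw [inv_mul_le_iff₀ hmax]
    exact h1.trans (mul_le_mul_of_nonneg_right (le_max_left C 1) (P.delta_nonneg _ _))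
  · exact h2.trans
      (mul_le_mul_of_nonneg_right (le_max_left C 1) (P.euclideanResidual_nonneg _ _))
end
end
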